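/- Let W be the Coxeter group of type D̃_{n+2} and let w ∈ FC(W) with s′ ∈ D_L(w) and s ∈ S with m_{s,s′} = 3. Then in TL(D̃_{n+2}) one has b_s b_w = b_x for some x ∈ FC(W); moreover x = sw if sw ∈ FC(W), and otherwise w = s′su reduced and x = su. -/

import Mathlib

open CoxeterSystem

namespace CoxFC


open CoxeterSystem


variable {B : Type*} {W : Type*} [Group W] {M : CoxeterMatrix B}

/-- One commutation move: swap two adjacent commuting letters. -/
def CommStep (M : CoxeterMatrix B) (l l' : List B) : Prop :=
  ∃ (l₁ l₂ : List B) (a b : B), M a b = 2 ∧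
    l = l₁ ++ a :: b :: l₂ ∧ l' = l₁ ++ b :: a :: l₂

/-- Two words are commutation equivalent if related by a sequence of commutation moves. -/
def CommEquiv (M : CoxeterMatrix B) : List B → List B → Prop :=
  Relation.ReflTransGen (CommStep M)

/-- A fully commutative element: any two reduced expressions are commutation equivalent. -/
def IsFC (cs : CoxeterSystem M W) (w : W) : Prop :=
  ∀ l l' : List B, cs.IsReduced l → cs.IsReduced l' →
    cs.wordProd l = w → cs.wordProd l' = w → CommEquiv M l l'

/-- `m s t ≥ 3`, where a matrix entry `0` denotes `∞`. -/
def Big (M : CoxeterMatrix B) (s t : B) : Prop := 3 ≤ M s t ∨ M s t = 0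

/-- `w` is left star reducible by `s` with respect to `t`. -/
def IsLeftStarReducible (cs : CoxeterSystem M W) (s t : B) (w : W) : Prop :=
  Big M s t ∧ cs.IsLeftDescent w s ∧ cs.IsLeftDescent (cs.simple s * w) t

/-- `w` is right star reducible by `s` with respect to `t`. -/
def IsRightStarReducible (cs : CoxeterSystem M W) (s t : B) (w : W) : Prop :=
  Big M s t ∧ cs.IsRightDescent w s ∧ cs.IsRightDescent (w * cs.simple s) t

/-- A single left star reduction step from `w` to `v`. -/
def LeftStarStep (cs : CoxeterSystem M W) (w v : W) : Prop :=
  ∃ s t : B, IsLeftStarReducible cs s t w ∧ v = cs.simple s * w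

/-- A single (left or right) star reduction step from `w` to `v`. -/
def StarStep (cs : CoxeterSystem M W) (w v : W) : Prop :=
  ∃ s t : B, (IsLeftStarReducible cs s t w ∧ v = cs.simple s * w) ∨
    (IsRightStarReducible cs s t w ∧ v = w * cs.simple s)

/-- `w` admits no left star reduction. -/
def LeftStarIrreducible (cs : CoxeterSystem M W) (w : W) : Prop :=
  ∀ s t : B, ¬ IsLeftStarReducible cs s t w

/-- `w` admits no star reduction at all. -/
def StarIrreducible (cs : CoxeterSystem M W) (w : W) : Prop :=
  ∀ s t : B, ¬ IsLeftStarReducible cs s t w ∧ ¬ IsRightStarReducible cs s t w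

/-- A product of pairwise commuting generators (including the identity). -/
def IsCC (cs : CoxeterSystem M W) (w : W) : Prop :=
  ∃ l : List B, cs.IsReduced l ∧ cs.wordProd l = w ∧
    ∀ a ∈ l, ∀ b ∈ l, a ≠ b → M a b = 2

/-- The support of `w`: generators appearing in some reduced expression. -/
def Supp (cs : CoxeterSystem M W) (w : W) : Set B :=
  {a | ∃ l : List B, cs.IsReduced l ∧ cs.wordProd l = w ∧ a ∈ l}

/-- `us` is the Cartier–Foata normal form of `w`, presented as a list of words,
each a product of pairwise commuting generators. -/
def IsCFNF (cs : CoxeterSystem M W) (w : W) (us : List (List B)) : Prop :=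
  (∀ l ∈ us, l ≠ []) ∧
  cs.wordProd us.flatten = w ∧
  cs.IsReduced us.flatten ∧
  (∀ l ∈ us, ∀ a ∈ l, ∀ b ∈ l, a ≠ b → M a b = 2) ∧
  (∀ a : B, (∃ l ∈ us.head?, a ∈ l) ↔ cs.IsLeftDescent w a) ∧
  (∀ j : ℕ, j + 1 < us.length → ∀ t ∈ us.getD (j+1) [],
      ∃ s ∈ us.getD j [], Big M s t)



/-- One orientation of the edges of the Coxeter graph of type D̃_{n+2}. -/
def DHalf (n a b : ℕ) : Prop :=
  (a = 0 ∧ b = 2) ∨ (a = 1 ∧ b = 2) ∨ (2 ≤ a ∧ a ≤ n ∧ b = a + 1) ∨ (a = n ∧ b = n + 2)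

/-- Adjacency (bond of order 3) in the Coxeter graph of type D̃_{n+2}:
`s_0, s_1` are joined to `s_2`, `s_2 — s_3 — ⋯ — s_n` is a path, and
`s_{n+1}, s_{n+2}` are joined to `s_n`. -/
def DAdj (n a b : ℕ) : Prop := DHalf n a b ∨ DHalf n b a

instance (n a b : ℕ) : Decidable (DAdj n a b) := by unfold DAdj DHalf; infer_instance

lemma dAdj_symm (n a b : ℕ) : DAdj n a b ↔ DAdj n b a := or_comm

lemma dHalf_ne (n a b : ℕ) (h : DHalf n a b) : a ≠ b := by unfold DHalf at h; omega

lemma dAdj_ne (n a b : ℕ) (h : DAdj n a b) : a ≠ b := by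
  rcases h with h | h
  · exact dHalf_ne n a b h
  · exact (dHalf_ne n b a h).symm

/-- The Coxeter matrix of affine type D̃_{n+2}, with vertices `s_0, …, s_{n+2}`. -/
def DMatrix (n : ℕ) : CoxeterMatrix (Fin (n+3)) where
  M := Matrix.of fun i j : Fin (n+3) ↦
    if DAdj n i j then 3 else if i = j then 1 else 2
  isSymm := by
    apply Matrix.IsSymm.ext
    intro i j
    simp only [Matrix.of_apply]
    by_cases h : DAdj n (i : ℕ) (j : ℕ)
    · rw [if_pos h, if_pos ((dAdj_symm n (i : ℕ) (j : ℕ)).mp h)]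
    · rw [if_neg h, if_neg (fun hh => h ((dAdj_symm n (j : ℕ) (i : ℕ)).mp hh))]
      by_cases h2 : (j : Fin (n+3)) = i
      · simp [h2]
      · rw [if_neg h2, if_neg (fun hh => h2 hh.symm)]
  diagonal i := by
    have : ¬ DAdj n (i : ℕ) (i : ℕ) := fun h => dAdj_ne n i i h rfl
    simp [this]
  off_diagonal i j h := by
    have h2 : (i : Fin (n+3)) ≠ j := h
    by_cases hA : DAdj n (i : ℕ) (j : ℕ) <;> simp [Matrix.of_apply, hA, h2]

/-- The generator `s_k` of type D̃_{n+2}, for `k ≤ n+2`. -/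
def dv (n k : ℕ) : Fin (n+3) := ⟨k % (n+3), Nat.mod_lt _ (Nat.succ_pos _)⟩




section Helpers

/-- Simply laced Coxeter matrices. -/
def Laced (M : CoxeterMatrix B) : Prop := ∀ i j : B, i ≠ j → M i j = 2 ∨ M i j = 3

theorem laced_DMatrix (n : ℕ) : Laced (DMatrix n) := by
  intro i j hij
  by_cases hA : DAdj n (i : ℕ) (j : ℕ)
  · right; simp [DMatrix, hA]
  · left; simp [DMatrix, hA, hij]

/-! ### Commutation classes -/

theorem CommStep.symm' {l l' : List B} (h : CommStep M l l') : CommStep M l' l := by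
  obtain ⟨l₁, l₂, a, b, hab, rfl, rfl⟩ := h
  exact ⟨l₁, l₂, b, a, by rw [M.symmetric]; exact hab, rfl, rfl⟩

theorem CommEquiv.symm' {l l' : List B} (h : CommEquiv M l l') : CommEquiv M l' l := by
  induction h with
  | refl => exact Relation.ReflTransGen.refl
  | tail _ h2 ih => exact Relation.ReflTransGen.head h2.symm' ih

theorem CommEquiv.trans' {l l' l'' : List B} (h : CommEquiv M l l') (h' : CommEquiv M l' l'') :
    CommEquiv M l l'' := Relation.ReflTransGen.trans h h'

theorem CommEquiv.cons' {l l' : List B} (a : B) (h : CommEquiv M l l') :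
    CommEquiv M (a :: l) (a :: l') := by
  induction h with
  | refl => exact Relation.ReflTransGen.refl
  | tail _ h2 ih =>
    refine Relation.ReflTransGen.tail ih ?_
    obtain ⟨l₁, l₂, x, y, hxy, rfl, rfl⟩ := h2
    exact ⟨a :: l₁, l₂, x, y, hxy, rfl, rfl⟩

theorem CommEquiv.perm' {l l' : List B} (h : CommEquiv M l l') : l.Perm l' := by
  induction h with
  | refl => exact List.Perm.refl _
  | tail _ h2 ih =>
    refine ih.trans ?_
    obtain ⟨l₁, l₂, x, y, hxy, rfl, rfl⟩ := h2
    exact List.Perm.append_left l₁ (List.Perm.swap _ _ _)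

open Classical in
theorem CommEquiv.erase' {l l' : List B} (a : B) (h : CommEquiv M l l') :
    CommEquiv M (l.erase a) (l'.erase a) := by
  induction h with
  | refl => exact Relation.ReflTransGen.refl
  | tail _ h2 ih =>
    refine CommEquiv.trans' ih ?_
    obtain ⟨l₁, l₂, x, y, hxy, rfl, rfl⟩ := h2
    have hne : x ≠ y := by
      rintro rfl
      rw [M.diagonal] at hxy
      omega
    by_cases h1 : a ∈ l₁
    · rw [List.erase_append_left _ h1, List.erase_append_left _ h1]
      exact Relation.ReflTransGen.single ⟨_, _, x, y, hxy, rfl, rfl⟩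
    · rw [List.erase_append_right _ h1, List.erase_append_right _ h1]
      by_cases hx : x = a
      · subst hx
        have : ¬ y = x := fun h => hne h.symm
        simp only [List.erase_cons, beq_iff_eq, if_true, this, if_false]
        exact Relation.ReflTransGen.refl
      · by_cases hy : y = a
        · subst hy
          simp only [List.erase_cons, beq_iff_eq, if_true, hx, if_false]
          exact Relation.ReflTransGen.refl
        · simp only [List.erase_cons, beq_iff_eq, hx, hy, if_false]
          exact Relation.ReflTransGen.single ⟨_, _, x, y, hxy, rfl, rfl⟩

theorem CommEquiv.of_cons {l l' : List B} {a : B} (h : CommEquiv M (a :: l) (a :: l')) :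
    CommEquiv M l l' := by
  classical
  have := CommEquiv.erase' a h
  simpa using this

theorem CommEquiv.swap' {a b : B} (l : List B) (h : M a b = 2) :
    CommEquiv M (a :: b :: l) (b :: a :: l) :=
  Relation.ReflTransGen.single ⟨[], l, a, b, h, rfl, rfl⟩

theorem CommEquiv.prod_eq {A : Type*} [Monoid A] {b : B → A}
    (hcomm : ∀ i j, M i j = 2 → b i * b j = b j * b i) {l l' : List B}
    (h : CommEquiv M l l') : (l.map b).prod = (l'.map b).prod := by
  induction h with
  | refl => rfl
  | tail _ h2 ih =>
    rw [ih]
    obtain ⟨l₁, l₂, x, y, hxy, rfl, rfl⟩ := h2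
    simp only [List.map_append, List.map_cons, List.prod_append, List.prod_cons]
    rw [← mul_assoc (b x), hcomm x y hxy, mul_assoc]

/-! ### Injectivity of the simple reflections (numbers game) -/

open Classical in
/-- The numbers game action. -/
noncomputable def game (M : CoxeterMatrix B) (i : B) : Function.End (B → ℤ) :=
  fun c k => if k = i then - c i else if M i k = 3 then c k + c i else c k

theorem game_liftable (hM : Laced M) : M.IsLiftable (game M) := by
  intro i j
  by_cases hij : i = j
  · subst hij
    rw [M.diagonal, pow_one]
    funext c k
    show game M i (game M i c) k = c k
    simp only [game]
    grind
  · have hs : M j i = M i j := M.symmetric j i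
    have hji : ¬ j = i := fun h => hij h.symm
    rcases hM i j hij with h | h
    · rw [h]
      funext c k
      show game M i (game M j (game M i (game M j c))) k = c k
      rw [h] at hs
      simp only [game]
      by_cases hki : k = i
      · subst hki; simp [h, hs, hij, hji]
      by_cases hkj : k = j
      · subst hkj; simp [h, hs, hij, hji]
      simp [h, hs, hij, hji, hki, hkj]
      grind
    · rw [h]
      funext c k
      show game M i (game M j (game M i (game M j (game M i (game M j c))))) k = c k
      rw [h] at hs
      simp only [game]
      by_cases hki : k = i
      · subst hki; simp [h, hs, hij, hji]
      by_cases hkj : k = j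
      · subst hkj; simp [h, hs, hij, hji]
      simp [h, hs, hij, hji, hki, hkj]
      grind

theorem simple_inj (hM : Laced M) (cs : CoxeterSystem M W) {i j : B}
    (h : cs.simple i = cs.simple j) : i = j := by
  classical
  by_contra hij
  have h1 := cs.lift_apply_simple (game_liftable hM) i
  have h2 := cs.lift_apply_simple (game_liftable hM) j
  rw [h, h2] at h1
  have h3 := congrFun (congrFun h1 (fun k => if k = i then 1 else 0)) i
  have hji : ¬ j = i := fun h => hij h.symm
  simp only [game, if_neg hij, if_neg hji, if_true] at h3
  split_ifs at h3 <;> omega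

/-! ### The exchange condition -/

open Classical in
/-- The reflection cocycle action. -/
noncomputable def refl (cs : CoxeterSystem M W) (i : B) : Function.End (W × ZMod 2) :=
  fun p => (cs.simple i * p.1 * cs.simple i, p.2 + if p.1 = cs.simple i then 1 else 0)

theorem conj_eq_iff (cs : CoxeterSystem M W) (i : B) (t u : W) :
    cs.simple i * t * cs.simple i = u ↔ t = cs.simple i * u * cs.simple i := by
  constructor
  · rintro rfl; simp [mul_assoc]
  · rintro rfl; simp [mul_assoc]

theorem simple_comm (cs : CoxeterSystem M W) {i j : B} (h : M i j = 2) :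
    cs.simple i * cs.simple j = cs.simple j * cs.simple i := by
  have := cs.simple_mul_simple_pow i j
  rw [h, pow_two] at this
  have := eq_inv_of_mul_eq_one_left this
  simpa using this

theorem simple_braid (cs : CoxeterSystem M W) {i j : B} (h : M i j = 3) :
    cs.simple i * cs.simple j * cs.simple i = cs.simple j * cs.simple i * cs.simple j := by
  have := cs.simple_mul_simple_pow i j
  rw [h, pow_succ, pow_two] at this
  have h2 : (cs.simple i * cs.simple j * cs.simple i) *
      (cs.simple j * cs.simple i * cs.simple j) = 1 := by
    rw [← this]; simp only [mul_assoc]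
  have := eq_inv_of_mul_eq_one_left h2
  simpa [mul_assoc] using this

theorem zmod2_add_self (a : ZMod 2) : a + a = 0 := by
  revert a; decide

theorem refl_liftable (hM : Laced M) (cs : CoxeterSystem M W) : M.IsLiftable (refl cs) := by
  classical
  intro i j
  by_cases hij : i = j
  · subst hij
    rw [M.diagonal, pow_one]
    funext p
    obtain ⟨t, e⟩ := p
    show refl cs i (refl cs i (t, e)) = (t, e)
    simp only [refl, conj_eq_iff]
    refine Prod.ext ?_ ?_
    · simp [mul_assoc]
    · simp only [simple_mul_simple_self, one_mul]
      rw [add_assoc, zmod2_add_self, add_zero]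
  · rcases hM i j hij with h | h
    · rw [h]
      funext p
      obtain ⟨t, e⟩ := p
      show refl cs i (refl cs j (refl cs i (refl cs j (t, e)))) = (t, e)
      have hc := simple_comm cs h
      have e1 : cs.simple j * cs.simple i * cs.simple j = cs.simple i := by
        rw [← hc]; simp
      have e2 : cs.simple i * cs.simple j * cs.simple i = cs.simple j := by
        rw [hc]; simp
      simp only [refl, conj_eq_iff, e1, e2, simple_mul_simple_self, one_mul]
      refine Prod.ext ?_ ?_
      · show cs.simple i * (cs.simple j * (cs.simple i * (cs.simple j * t * cs.simple j) *
          cs.simple i) * cs.simple j) * cs.simple i = t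
        have a1 : cs.simple i * cs.simple j * cs.simple i * cs.simple j = 1 := by
          rw [e2]; simp
        have a2 : cs.simple j * cs.simple i * cs.simple j * cs.simple i = 1 := by
          rw [e1]; simp
        calc _ = (cs.simple i * cs.simple j * cs.simple i * cs.simple j) * t *
              (cs.simple j * cs.simple i * cs.simple j * cs.simple i) := by
              simp only [mul_assoc]
          _ = t := by rw [a1, a2]; simp
      · show _ = e
        generalize (if t = cs.simple j then (1 : ZMod 2) else 0) = x
        generalize (if t = cs.simple i then (1 : ZMod 2) else 0) = y
        dsimp only
        revert e x y; decide
    · rw [h]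
      funext p
      obtain ⟨t, e⟩ := p
      show refl cs i (refl cs j (refl cs i (refl cs j (refl cs i (refl cs j (t, e)))))) = (t, e)
      have hc := simple_braid cs h
      have e3 : cs.simple j * (cs.simple i * cs.simple j * cs.simple i) * cs.simple j =
          cs.simple i := by
        rw [hc]; simp [mul_assoc]
      have e4 : cs.simple i * (cs.simple i * cs.simple j * cs.simple i) * cs.simple i =
          cs.simple j := by
        simp [mul_assoc]
      simp only [refl, conj_eq_iff, ← hc, e3, e4, simple_mul_simple_self, one_mul]
      refine Prod.ext ?_ ?_
      · show cs.simple i * (cs.simple j * (cs.simple i * (cs.simple j * (cs.simple i *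
          (cs.simple j * t * cs.simple j) * cs.simple i) * cs.simple j) *
          cs.simple i) * cs.simple j) * cs.simple i = t
        have a1 : (cs.simple i * cs.simple j * cs.simple i) *
            (cs.simple j * cs.simple i * cs.simple j) = 1 := by
          rw [hc]; simp [mul_assoc]
        have a2 : (cs.simple j * cs.simple i * cs.simple j) *
            (cs.simple i * cs.simple j * cs.simple i) = 1 := by
          rw [hc]; simp [mul_assoc]
        calc _ = ((cs.simple i * cs.simple j * cs.simple i) *
              (cs.simple j * cs.simple i * cs.simple j)) * t *
              ((cs.simple j * cs.simple i * cs.simple j) *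
              (cs.simple i * cs.simple j * cs.simple i)) := by
              simp only [mul_assoc]
          _ = t := by rw [a1, a2]; simp
      · show _ = e
        generalize (if t = cs.simple j then (1 : ZMod 2) else 0) = x
        generalize (if t = cs.simple i then (1 : ZMod 2) else 0) = y
        generalize (if t = cs.simple i * cs.simple j * cs.simple i then (1 : ZMod 2) else 0) = z
        dsimp only
        revert e x y z; decide

open Classical in
theorem lift_refl_apply (hM : Laced M) (cs : CoxeterSystem M W) (ω : List B) (t : W)
    (e : ZMod 2) :
    (cs.lift ⟨refl cs, refl_liftable hM cs⟩ (cs.wordProd ω)⁻¹ (t, e)).2 =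
      e + ((cs.leftInvSeq ω).count t : ℕ) := by
  induction ω generalizing t e with
  | nil => simp; rfl
  | cons i ω ih =>
    rw [cs.wordProd_cons, mul_inv_rev, cs.inv_simple, map_mul,
      cs.lift_apply_simple (refl_liftable hM cs) i]
    show (cs.lift ⟨refl cs, refl_liftable hM cs⟩ (cs.wordProd ω)⁻¹ (refl cs i (t, e))).2 = _
    rw [refl, ih]
    have hcount : (List.map (MulAut.conj (cs.simple i)) (cs.leftInvSeq ω)).count t =
        (cs.leftInvSeq ω).count (cs.simple i * t * cs.simple i) := by
      have : t = MulAut.conj (cs.simple i) (cs.simple i * t * cs.simple i) := by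
        simp [mul_assoc]
      conv_lhs => rw [this]
      exact List.count_map_of_injective _ _ (MulAut.conj (cs.simple i)).injective _
    rw [CoxeterSystem.leftInvSeq, List.count_cons, hcount]
    by_cases hti : t = cs.simple i
    · simp [hti]; ring
    · have : ¬ cs.simple i = t := fun h => hti h.symm
      simp [hti, this]

theorem exchange (hM : Laced M) (cs : CoxeterSystem M W) (ω : List B) (i : B)
    (h : cs.IsLeftDescent (cs.wordProd ω) i) :
    ∃ j < ω.length, cs.simple i * cs.wordProd ω = cs.wordProd (ω.eraseIdx j) := by
  classical
  obtain ⟨ω', hω', he⟩ := cs.exists_isReduced (cs.simple i * cs.wordProd ω)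
  have hp : cs.wordProd (i :: ω') = cs.wordProd ω := by
    rw [cs.wordProd_cons, ← he]; simp
  have hred : cs.IsReduced (i :: ω') := by
    rw [cs.isLeftDescent_iff, he, hω'.eq] at h
    unfold CoxeterSystem.IsReduced
    rw [hp, ← h]; simp
  have h1 := lift_refl_apply hM cs ω (cs.simple i) 0
  have h2 := lift_refl_apply hM cs (i :: ω') (cs.simple i) 0
  rw [hp, h1] at h2
  have h3 : (cs.leftInvSeq (i :: ω')).count (cs.simple i) = 1 :=
    List.count_eq_one_of_mem (IsReduced.nodup_leftInvSeq cs hred)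
      (by simp [CoxeterSystem.leftInvSeq])
  have hmem : cs.simple i ∈ cs.leftInvSeq ω := by
    by_contra hn
    rw [List.count_eq_zero_of_not_mem hn, h3] at h2
    simp at h2
  obtain ⟨j, hj, hje⟩ := List.mem_iff_getElem.mp hmem
  refine ⟨j, by simpa using hj, ?_⟩
  rw [← cs.getD_leftInvSeq_mul_wordProd, List.getD_eq_getElem _ 1 hj, hje]

/-! ### Two descents -/

theorem length_simple_mul_le (cs : CoxeterSystem M W) (i : B) (v : W) :
    cs.length (cs.simple i * v) ≤ cs.length v + 1 := by
  rcases cs.length_simple_mul v i with h | h <;> omega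

theorem two_descents (hM : Laced M) (cs : CoxeterSystem M W) {y : W} {s t : B} (hst : s ≠ t)
    (hs : cs.IsLeftDescent y s) (ht : cs.IsLeftDescent y t) :
    ∃ v, y = cs.simple s * (cs.simple t * v) ∧ cs.length y = cs.length v + 2 := by
  obtain ⟨ω, hω, he⟩ := cs.exists_isReduced (cs.simple t * y)
  have hy : y = cs.wordProd (t :: ω) := by rw [cs.wordProd_cons, ← he]; simp
  have hl : ω.length + 1 = cs.length y := by
    rw [cs.isLeftDescent_iff, he, hω.eq] at ht; exact ht
  rw [hy] at hs
  obtain ⟨j, hj, hje⟩ := exchange hM cs _ _ hs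
  rw [← hy] at hje
  cases j with
  | zero =>
    exfalso
    simp only [List.eraseIdx_cons_zero] at hje
    rw [← he] at hje
    exact hst (simple_inj hM cs (mul_right_cancel hje))
  | succ j =>
    rw [List.eraseIdx_cons_succ, cs.wordProd_cons] at hje
    simp only [List.length_cons] at hj
    refine ⟨cs.wordProd (ω.eraseIdx j), by rw [← hje]; simp, ?_⟩
    have h1 := cs.length_wordProd_le (ω.eraseIdx j)
    have h2 := List.length_eraseIdx_add_one (l := ω) (i := j) (by omega)
    have h3 : y = cs.simple s * (cs.simple t * cs.wordProd (ω.eraseIdx j)) := by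
      rw [← hje]; simp
    have h4 := length_simple_mul_le cs s (cs.simple t * cs.wordProd (ω.eraseIdx j))
    have h5 := length_simple_mul_le cs t (cs.wordProd (ω.eraseIdx j))
    rw [← h3] at h4
    omega

theorem two_descents3 (hM : Laced M) (cs : CoxeterSystem M W) {y : W} {s t : B} (hst : M s t = 3)
    (hs : cs.IsLeftDescent y s) (ht : cs.IsLeftDescent y t) :
    ∃ v, y = cs.simple s * (cs.simple t * (cs.simple s * v)) ∧
      y = cs.simple t * (cs.simple s * (cs.simple t * v)) ∧ cs.length y = cs.length v + 3 := by
  have hne : s ≠ t := by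
    rintro rfl
    rw [M.diagonal] at hst; omega
  have hb := simple_braid cs hst
  obtain ⟨v, hv, hvl⟩ := two_descents hM cs hne hs ht
  obtain ⟨ω, hω, he⟩ := cs.exists_isReduced v
  have hy : y = cs.wordProd (s :: t :: ω) := by rw [cs.wordProd_cons, cs.wordProd_cons, ← he, hv]
  have hl : ω.length = cs.length v := by rw [he, hω.eq]
  rw [hy] at ht
  obtain ⟨j, hj, hje⟩ := exchange hM cs _ _ ht
  rw [← hy] at hje
  match j, hj, hje with
  | 0, _, hje =>
    exfalso
    simp only [List.eraseIdx_cons_zero, cs.wordProd_cons, ← he] at hje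
    have : y = v := mul_left_cancel hje
    rw [this] at hvl; omega
  | 1, _, hje =>
    exfalso
    simp only [List.eraseIdx_cons_succ, List.eraseIdx_cons_zero, cs.wordProd_cons, ← he] at hje
    rw [hv] at hje
    have h1 : cs.simple t * cs.simple s * cs.simple t = cs.simple s := by
      apply mul_right_cancel (b := v)
      rw [← hje]; simp only [mul_assoc]
    rw [← hb] at h1
    have h2 : cs.simple s * cs.simple t = 1 := mul_right_cancel (b := cs.simple s) (by simpa using h1)
    have h3 := eq_inv_of_mul_eq_one_left h2
    rw [cs.inv_simple] at h3
    exact hne (simple_inj hM cs h3)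
  | j + 2, hj, hje =>
    simp only [List.length_cons] at hj
    simp only [List.eraseIdx_cons_succ, cs.wordProd_cons] at hje
    have h1 := cs.length_wordProd_le (ω.eraseIdx j)
    have h2 := List.length_eraseIdx_add_one (l := ω) (i := j) (by omega)
    set v' := cs.wordProd (ω.eraseIdx j)
    have h3 : y = cs.simple t * (cs.simple s * (cs.simple t * v')) := by
      rw [← hje]; simp
    refine ⟨v', ?_, h3, ?_⟩
    · rw [h3]
      simp only [← mul_assoc]
      rw [hb]
    · have h4 := length_simple_mul_le cs t (cs.simple s * (cs.simple t * v'))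
      have h5 := length_simple_mul_le cs s (cs.simple t * v')
      have h6 := length_simple_mul_le cs t v'
      rw [← h3] at h4
      omega

/-! ### Fully commutative elements -/

theorem fc_descents (hM : Laced M) (cs : CoxeterSystem M W) {y : W} (hy : IsFC cs y) {s t : B}
    (hst : s ≠ t) (hs : cs.IsLeftDescent y s) (ht : cs.IsLeftDescent y t) : M s t = 2 := by
  classical
  rcases hM s t hst with h | h
  · exact h
  exfalso
  obtain ⟨v, h1, h2, h3⟩ := two_descents3 hM cs h hs ht
  obtain ⟨ω, hω, he⟩ := cs.exists_isReduced v
  have hl : ω.length = cs.length v := by rw [he, hω.eq]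
  have e1 : cs.wordProd (s :: t :: s :: ω) = y := by
    simp only [cs.wordProd_cons, ← he]; exact h1.symm
  have e2 : cs.wordProd (t :: s :: t :: ω) = y := by
    simp only [cs.wordProd_cons, ← he]; exact h2.symm
  have hc := (hy _ _ (by unfold CoxeterSystem.IsReduced; rw [e1]; simp; omega)
    (by unfold CoxeterSystem.IsReduced; rw [e2]; simp; omega) e1 e2).perm'
  have := hc.count_eq s
  have hts : ¬ t = s := fun h => hst h.symm
  simp [List.count_cons, hts] at this

theorem fc_tail (cs : CoxeterSystem M W) {v : W} {s : B} (hy : IsFC cs (cs.simple s * v))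
    (hl : cs.length (cs.simple s * v) = cs.length v + 1) : IsFC cs v := by
  intro l l' h h' e e'
  refine CommEquiv.of_cons (a := s) (hy _ _ ?_ ?_ ?_ ?_)
  · unfold CoxeterSystem.IsReduced at h ⊢; rw [cs.wordProd_cons, e, hl, ← e, h]; simp
  · unfold CoxeterSystem.IsReduced at h' ⊢; rw [cs.wordProd_cons, e', hl, ← e', h']; simp
  · rw [cs.wordProd_cons, e]
  · rw [cs.wordProd_cons, e']

theorem red_cons (cs : CoxeterSystem M W) {v : W} {s : B} {l : List B} (h : cs.IsReduced l)
    (e : cs.wordProd l = v) (hl : cs.length (cs.simple s * v) = cs.length v + 1) :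
    cs.IsReduced (s :: l) ∧ cs.wordProd (s :: l) = cs.simple s * v := by
  refine ⟨?_, by rw [cs.wordProd_cons, e]⟩
  unfold CoxeterSystem.IsReduced at h ⊢; rw [cs.wordProd_cons, e, hl, ← e, h]; simp

theorem length_up (hM : Laced M) (cs : CoxeterSystem M W) {w : W} (hw : IsFC cs w) {s s' : B}
    (hs' : cs.IsLeftDescent w s') (hm : M s s' = 3) :
    cs.length (cs.simple s * w) = cs.length w + 1 := by
  rw [← cs.not_isLeftDescent_iff]
  intro hs
  have hne : s ≠ s' := by
    rintro rfl
    rw [M.diagonal] at hm; omega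
  have := fc_descents hM cs hw hne hs hs'
  omega

theorem desc_of (cs : CoxeterSystem M W) {v : W} {s : B}
    (hl : cs.length v < cs.length (cs.simple s * v)) :
    cs.IsLeftDescent (cs.simple s * v) s := by
  unfold CoxeterSystem.IsLeftDescent
  simpa using hl

theorem main_step (hM : Laced M) (cs : CoxeterSystem M W) {s s' : B} (hm : M s s' = 3) (N : ℕ) :
    ∀ w : W, cs.length w = N → IsFC cs w → cs.IsLeftDescent w s' →
      ¬ IsFC cs (cs.simple s * w) →
      ∃ u : W, w = cs.simple s' * (cs.simple s * u) ∧ cs.length w = cs.length u + 2 := by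
  have hss : s ≠ s' := by
    rintro rfl
    rw [M.diagonal] at hm; omega
  induction N with
  | zero =>
    intro w h0 _ hd _
    unfold CoxeterSystem.IsLeftDescent at hd
    omega
  | succ N IH =>
  intro w hN hw hd hn
  have hup := length_up hM cs hw hd hm
  obtain ⟨lw, hlw, hew⟩ := cs.exists_isReduced w
  obtain ⟨hr, hp⟩ := red_cons cs hlw hew.symm hup
  -- a word of `s w` which is not equivalent to `s :: lw`
  obtain ⟨l, hl, hle, hne⟩ : ∃ l, cs.IsReduced l ∧ cs.wordProd l = cs.simple s * w ∧
      ¬ CommEquiv M l (s :: lw) := by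
    by_contra hcon
    push Not at hcon
    exact hn fun l l' h h' e e' => (hcon l h e).trans' (hcon l' h' e').symm'
  cases l with
  | nil =>
    exfalso
    rw [cs.wordProd_nil] at hle
    rw [← hle] at hup
    simp at hup
  | cons t l1 =>
  have hl1 : cs.IsReduced l1 := by simpa using hl.drop 1
  rw [cs.wordProd_cons] at hle
  have hty : cs.simple t * (cs.simple s * w) = cs.wordProd l1 := by
    rw [← hle]; simp
  have hdt : cs.IsLeftDescent (cs.simple s * w) t := by
    unfold CoxeterSystem.IsLeftDescent
    have := hl.eq
    rw [cs.wordProd_cons, hle] at this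
    rw [hty, hl1.eq, this]; simp
  have hds : cs.IsLeftDescent (cs.simple s * w) s := desc_of cs (by omega)
  by_cases hts : s = t
  · exfalso
    subst hts
    apply hne
    refine CommEquiv.cons' _ (hw _ _ hl1 hlw ?_ hew.symm)
    rw [← hty]; simp
  rcases hM s t hts with h2 | h3
  · -- commuting case
    obtain ⟨v, hv, hvl⟩ := two_descents hM cs hts hds hdt
    have hwv : w = cs.simple t * v := mul_left_cancel hv
    have hts' : t ≠ s' := by
      rintro rfl; omega
    have hlv : cs.length (cs.simple t * v) = cs.length v + 1 := by
      rw [← hwv]; omega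
    have hfv : IsFC cs v := fc_tail cs (s := t) (by rw [← hwv]; exact hw) hlv
    have hdtw : cs.IsLeftDescent w t := by
      rw [hwv]; exact desc_of cs (by omega)
    have hmt := fc_descents hM cs hw hts' hdtw hd
    obtain ⟨v', hv', hvl'⟩ := two_descents hM cs hts' hdtw hd
    have hvv : v = cs.simple s' * v' := by
      rw [hwv] at hv'; exact mul_left_cancel hv'
    have hdv : cs.IsLeftDescent v s' := by
      have : cs.length v = cs.length v' + 1 := by rw [hwv] at hvl'; omega
      rw [hvv] at this ⊢
      exact desc_of cs (by omega)
    have hsv := length_up hM cs hfv hdv hm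
    have htsv : cs.wordProd l1 = cs.simple s * v := by
      rw [← hty, hv, ← mul_assoc (cs.simple s), simple_comm cs h2]; simp [mul_assoc]
    by_cases hF : IsFC cs (cs.simple s * v)
    · exfalso
      obtain ⟨lv, hlv', hev⟩ := cs.exists_isReduced v
      obtain ⟨a1, a2⟩ := red_cons cs hlv' hev.symm hsv
      obtain ⟨b1, b2⟩ := red_cons cs hlv' hev.symm hlv
      apply hne
      refine ((hF _ _ hl1 a1 htsv a2).cons' t).trans' ?_
      refine (CommEquiv.swap' lv (by rw [M.symmetric]; exact h2)).trans' ?_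
      exact CommEquiv.cons' s (hw _ _ b1 hlw (by rw [b2, hwv]) hew.symm)
    · obtain ⟨u, hu, hul⟩ := IH v (by rw [hwv] at hN; omega) hfv hdv hF
      have hw' : w = cs.simple s' * (cs.simple s * (cs.simple t * u)) := by
        rw [hwv, hu, ← mul_assoc, simple_comm cs hmt, mul_assoc]
        congr 1
        rw [← mul_assoc, ← simple_comm cs h2, mul_assoc]
      refine ⟨cs.simple t * u, hw', ?_⟩
      have c1 := length_simple_mul_le cs s' (cs.simple s * (cs.simple t * u))
      have c2 := length_simple_mul_le cs s (cs.simple t * u)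
      have c3 := length_simple_mul_le cs t u
      rw [← hw'] at c1
      rw [← hwv] at hlv
      omega
  · -- braid case
    obtain ⟨u, hu, -, hul⟩ := two_descents3 hM cs h3 hds hdt
    have hwu : w = cs.simple t * (cs.simple s * u) := mul_left_cancel hu
    by_cases hts' : t = s'
    · subst hts'
      exact ⟨u, hwu, by omega⟩
    exfalso
    have c1 := length_simple_mul_le cs t (cs.simple s * u)
    have c2 := length_simple_mul_le cs s u
    rw [← hwu] at c1
    have hdtw : cs.IsLeftDescent w t := by
      rw [hwu]; exact desc_of cs (by rw [← hwu]; omega)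
    obtain ⟨v, hv, hvl⟩ := two_descents hM cs hts' hdtw hd
    have hsu : cs.simple s * u = cs.simple s' * v := by
      rw [hwu] at hv; exact mul_left_cancel hv
    have hf : IsFC cs (cs.simple s * u) :=
      fc_tail cs (s := t) (by rw [← hwu]; exact hw) (by rw [← hwu]; omega)
    have d1 : cs.IsLeftDescent (cs.simple s * u) s := desc_of cs (by omega)
    have d2 : cs.IsLeftDescent (cs.simple s * u) s' := by
      rw [hsu]; exact desc_of cs (by rw [← hsu]; omega)
    have := fc_descents hM cs hf hss d1 d2
    omega

end Helpers

theorem stmt13 (n : ℕ) (hn : 2 ≤ n) {W : Type*} [Group W]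
    (cs : CoxeterSystem (DMatrix n) W)
    {A : Type*} [Ring A] [Algebra (Polynomial ℤ) A]
    (b : Fin (n+3) → A)
    (hsq : ∀ i, b i * b i = algebraMap (Polynomial ℤ) A Polynomial.X * b i)
    (hcomm : ∀ i j, DMatrix n i j = 2 → b i * b j = b j * b i)
    (hbraid : ∀ i j, DMatrix n i j = 3 → b i * b j * b i = b i)
    (w : W) (hw : IsFC cs w) (s s' : Fin (n+3))
    (hs' : cs.IsLeftDescent w s') (hm : DMatrix n s s' = 3) :
    ∃ x : W, IsFC cs x ∧
      (∀ lw lx : List (Fin (n+3)), cs.IsReduced lw → cs.wordProd lw = w →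
        cs.IsReduced lx → cs.wordProd lx = x →
        b s * (lw.map b).prod = (lx.map b).prod) ∧
      (IsFC cs (cs.simple s * w) → x = cs.simple s * w) ∧
      (¬ IsFC cs (cs.simple s * w) →
        ∃ u : W, w = cs.simple s' * cs.simple s * u ∧
          cs.length w = cs.length u + 2 ∧ x = cs.simple s * u) := by
  have hM := laced_DMatrix n
  have hup := length_up hM cs hw hs' hm
  by_cases hF : IsFC cs (cs.simple s * w)
  · refine ⟨cs.simple s * w, hF, ?_, fun _ => rfl, fun h => absurd hF h⟩
    intro lw lx h1 h2 h3 h4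
    obtain ⟨r, p⟩ := red_cons cs h1 h2 hup
    rw [← CommEquiv.prod_eq hcomm (hF _ _ r h3 p h4)]
    simp
  · obtain ⟨u, hu, hul⟩ := main_step hM cs hm _ w rfl hw hs' hF
    have c1 := length_simple_mul_le cs s' (cs.simple s * u)
    have c2 := length_simple_mul_le cs s u
    rw [← hu] at c1
    have hx : IsFC cs (cs.simple s * u) :=
      fc_tail cs (s := s') (by rw [← hu]; exact hw) (by rw [← hu]; omega)
    refine ⟨cs.simple s * u, hx, ?_, fun h => absurd h hF,
      fun _ => ⟨u, by rw [mul_assoc]; exact hu, hul, rfl⟩⟩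
    intro lw lx h1 h2 h3 h4
    obtain ⟨lu, hlu, heu⟩ := cs.exists_isReduced u
    obtain ⟨r1, p1⟩ := red_cons (s := s) cs hlu heu.symm (by omega)
    obtain ⟨r2, p2⟩ := red_cons (s := s') cs r1 p1 (by rw [← hu]; omega)
    rw [CommEquiv.prod_eq hcomm (hw _ _ h1 r2 h2 (by rw [p2, ← hu])),
      CommEquiv.prod_eq hcomm (hx _ _ h3 r1 h4 p1)]
    simp only [List.map_cons, List.prod_cons]
    rw [← mul_assoc, ← mul_assoc, hbraid s s' hm]


end CoxFC
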